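/- (Decomposition form of the final value theorem.) Let μ ≥ -1/2 and 3/2 < η < μ + 2. Suppose f = g + h where g satisfies the classical FVT hypotheses with limit constant δ (x^{μ+1/2}g(x) Lebesgue integrable on (0,X) for every X < ∞, and lim_{x→∞} e^{-ix²c₁/2} x^{η-1/2} g(x) = δ c₂^{3/2-η}/C_{α,μ}), and h is a compactly supported distribution on (0,∞) whose transform H(ξ) = ⟨h(x), K_α(x,ξ)⟩ satisfies |H(ξ)| ≤ K ξ^{μ+1} for 0 < ξ < 1. Then lim_{ξ→0⁺} e^{iξ²c₁/2} ξ^{3/2-η} (H^α_μ f)(ξ) = δ · Γ(1+μ/2-η/2)/(2^{η-1}Γ(μ/2+η/2)). -/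

import Mathlib

open MeasureTheory Filter Set

/-- Bessel function of the first kind of order `μ`. -/
noncomputable def besselJ (μ x : ℝ) : ℝ :=
  (x / 2) ^ μ *
    ∑' n : ℕ, ((-1 : ℝ) ^ n / ((n.factorial : ℝ) * Real.Gamma (μ + n + 1))) * (x / 2) ^ (2 * n)

/-- The constant `C_{α,μ} = e^{i(1+μ)(π/2-α)}/ sin α`. -/
noncomputable def Cst (α μ : ℝ) : ℂ :=
  Complex.exp (Complex.I * ((1 + μ) * (Real.pi / 2 - α) : ℝ)) / (Real.sin α : ℂ)

/-- The fractional Hankel transform kernel (for `α ≠ π/2`),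
`K_α(x,ξ) = C_{α,μ} e^{-i(x²+ξ²)c₁/2} √(xξc₂) J_μ(xξc₂)` with `c₁ = cot α`, `c₂ = csc α`. -/
noncomputable def frhtKernel (α μ x ξ : ℝ) : ℂ :=
  Cst α μ * Complex.exp (-Complex.I * (((x ^ 2 + ξ ^ 2) / 2 * Real.cot α : ℝ) : ℂ)) *
    ((Real.sqrt (x * ξ * (Real.sin α)⁻¹) * besselJ μ (x * ξ * (Real.sin α)⁻¹) : ℝ) : ℂ)

/-- The fractional Hankel transform of a function. -/
noncomputable def frht (α μ : ℝ) (f : ℝ → ℂ) (ξ : ℝ) : ℂ :=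
  ∫ x in Set.Ioi (0 : ℝ), frhtKernel α μ x ξ * f x

/-- The classical Hankel transform of order `μ`. -/
noncomputable def hankel (μ : ℝ) (g : ℝ → ℂ) (ξ : ℝ) : ℂ :=
  ∫ x in Set.Ioi (0 : ℝ), ((Real.sqrt (x * ξ) * besselJ μ (x * ξ) : ℝ) : ℂ) * g x

/-- `H(μ,η) = Γ(1+μ/2-η/2)/(2^{η-1} Γ(μ/2+η/2))`. -/
noncomputable def Hconst (μ η : ℝ) : ℝ :=
  Real.Gamma (1 + μ / 2 - η / 2) / (2 ^ (η - 1) * Real.Gamma (μ / 2 + η / 2))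

/-- `L` is slowly varying at the origin. -/
def SlowlyVaryingAtZero (L : ℝ → ℝ) : Prop :=
  ∀ a > 0, Filter.Tendsto (fun ε => L (a * ε) / L ε) (nhdsWithin 0 (Set.Ioi 0)) (nhds 1)

/-- The `n`-th Taylor coefficient of the Bessel–Clifford function of order `μ`. -/
noncomputable def besselCliffordCoeff (μ : ℝ) (n : ℕ) : ℝ :=
  (-1 : ℝ) ^ n / ((n.factorial : ℝ) * Real.Gamma (μ + n + 1))

/-- The entire function `B` with `J_μ(x) = (x/2)^μ B((x/2)²)`. -/
noncomputable def besselClifford (μ z : ℝ) : ℝ :=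
  ∑' n : ℕ, besselCliffordCoeff μ n * z ^ n

theorem besselJ_eq_rpow_mul_besselClifford (μ x : ℝ) :
    besselJ μ x = (x / 2) ^ μ * besselClifford μ ((x / 2) ^ 2) := by
  simp only [besselJ, besselClifford, besselCliffordCoeff, pow_mul]

section BesselClifford

variable {μ : ℝ}

theorem Gamma_add_natCast_add_one_pos (hμ : -1 < μ) (n : ℕ) : 0 < Real.Gamma (μ + n + 1) :=
  Real.Gamma_pos_of_pos (by have : (0 : ℝ) ≤ n := n.cast_nonneg; linarith)

theorem besselCliffordCoeff_ne_zero (hμ : -1 < μ) (n : ℕ) : besselCliffordCoeff μ n ≠ 0 := by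
  have := (Gamma_add_natCast_add_one_pos hμ n).ne'
  unfold besselCliffordCoeff
  positivity

theorem besselCliffordCoeff_succ (hμ : -1 < μ) (n : ℕ) :
    besselCliffordCoeff μ (n + 1) =
      -besselCliffordCoeff μ n / ((n + 1) * (μ + n + 1)) := by
  have hn : (0 : ℝ) ≤ n := n.cast_nonneg
  have hG := (Gamma_add_natCast_add_one_pos hμ n).ne'
  have hp : μ + n + 1 ≠ 0 := by linarith
  have hrec : Real.Gamma (μ + (n + 1 : ℕ) + 1) = (μ + n + 1) * Real.Gamma (μ + n + 1) := by
    rw [← Real.Gamma_add_one hp]; push_cast; ring_nf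
  unfold besselCliffordCoeff
  rw [hrec, Nat.factorial_succ]
  push_cast
  field_simp
  ring

theorem succ_mul_besselCliffordCoeff_succ (n : ℕ) :
    (n + 1) * besselCliffordCoeff μ (n + 1) = -besselCliffordCoeff (μ + 1) n := by
  have hn : (n : ℝ) + 1 ≠ 0 := by positivity
  have harg : μ + (n + 1 : ℕ) + 1 = μ + 1 + n + 1 := by push_cast; ring
  unfold besselCliffordCoeff
  rw [harg, Nat.factorial_succ, pow_succ]
  push_cast
  rw [mul_div_assoc', mul_assoc ((n : ℝ) + 1), mul_div_mul_left _ _ hn]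
  ring

theorem summable_besselCliffordCoeff_mul_pow (hμ : -1 < μ) (z : ℝ) :
    Summable fun n => besselCliffordCoeff μ n * z ^ n := by
  rcases eq_or_ne z 0 with rfl | hz
  · exact summable_of_ne_finset_zero (s := {0}) fun n hn => by
      rw [zero_pow (by simpa using hn), mul_zero]
  refine summable_of_ratio_test_tendsto_lt_one zero_lt_one
    (.of_forall fun n => mul_ne_zero (besselCliffordCoeff_ne_zero hμ n) (pow_ne_zero n hz)) ?_
  have hlim : Tendsto (fun n : ℕ => ((n : ℝ) + 1) * (μ + n + 1)) atTop atTop := by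
    refine Tendsto.atTop_mul_atTop₀ ?_ ?_
    · exact tendsto_atTop_add_const_right _ _ tendsto_natCast_atTop_atTop
    · exact tendsto_atTop_add_const_right _ _
        (tendsto_atTop_add_const_left _ _ tendsto_natCast_atTop_atTop)
  refine (hlim.const_div_atTop |z|).congr fun n => ?_
  have hn : (0 : ℝ) ≤ n := n.cast_nonneg
  have hp : 0 < μ + n + 1 := by linarith
  have hc := besselCliffordCoeff_ne_zero hμ n
  rw [besselCliffordCoeff_succ hμ, pow_succ]
  simp only [norm_mul, norm_div, norm_neg, norm_pow, Real.norm_eq_abs, abs_of_pos hp,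
    abs_of_pos (by positivity : (0 : ℝ) < n + 1)]
  have hc' := abs_ne_zero.mpr hc
  have hz' := abs_ne_zero.mpr hz
  field_simp

theorem hasDerivAt_besselClifford (hμ : -1 < μ) (z : ℝ) :
    HasDerivAt (besselClifford μ) (-besselClifford (μ + 1) z) z := by
  have hμ' : -1 < μ + 1 := by linarith
  have hterm (y : ℝ) (n : ℕ) : besselCliffordCoeff μ (n + 1) * ((n + 1 : ℕ) * y ^ n) =
      -(besselCliffordCoeff (μ + 1) n * y ^ n) := by
    have := succ_mul_besselCliffordCoeff_succ (μ := μ) n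
    push_cast
    linear_combination y ^ n * this
  have hsum (y : ℝ) :
      Summable fun n : ℕ => besselCliffordCoeff μ n * ((n : ℕ) * y ^ (n - 1)) := by
    rw [← summable_nat_add_iff 1]
    simp only [Nat.add_sub_cancel, hterm]
    exact (summable_besselCliffordCoeff_mul_pow hμ' y).neg
  have key := hasDerivAt_tsum_of_isPreconnected (hsum (|z| + 1)).norm
    (Metric.isOpen_ball (x := (0 : ℝ)) (ε := |z| + 1)) (convex_ball _ _).isPreconnected
    (g := fun n y => besselCliffordCoeff μ n * y ^ n)
    (fun n y _ => (hasDerivAt_pow n y).const_mul _) (fun n y hy => ?_)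
    (Metric.mem_ball_self (by positivity)) (summable_besselCliffordCoeff_mul_pow hμ 0)
    (y := z) (by simp)
  · convert! key using 1
    rw [(hsum z).tsum_eq_zero_add]
    simp only [Nat.add_sub_cancel, hterm, tsum_neg, besselClifford]
    simp
  · rw [mem_ball_zero_iff, Real.norm_eq_abs] at hy
    simp only [norm_mul, norm_pow, Real.norm_eq_abs, Nat.abs_cast]
    rw [abs_of_pos (by positivity : 0 < |z| + 1)]
    gcongr

theorem continuous_besselClifford (hμ : -1 < μ) : Continuous (besselClifford μ) :=
  continuous_iff_continuousAt.mpr fun z => (hasDerivAt_besselClifford hμ z).continuousAt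

theorem mul_besselClifford_add_two (hμ : -1 < μ) (z : ℝ) :
    z * besselClifford (μ + 2) z =
      (μ + 1) * besselClifford (μ + 1) z - besselClifford μ z := by
  have s₀ := summable_besselCliffordCoeff_mul_pow hμ z
  have s₁ := summable_besselCliffordCoeff_mul_pow (by linarith : -1 < μ + 1) z
  have hcoeff₁ (n : ℕ) :
      besselCliffordCoeff μ n = (μ + 1 + n) * besselCliffordCoeff (μ + 1) n := by
    have hn : (0 : ℝ) ≤ n := n.cast_nonneg
    have hp : μ + n + 1 ≠ 0 := by linarith
    have hs := besselCliffordCoeff_succ hμ n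
    have ht := succ_mul_besselCliffordCoeff_succ (μ := μ) n
    rw [hs] at ht
    field_simp at ht
    linear_combination -ht
  have hcoeff₂ (n : ℕ) :
      (n + 1) * besselCliffordCoeff (μ + 1) (n + 1) = -besselCliffordCoeff (μ + 2) n := by
    rw [succ_mul_besselCliffordCoeff_succ, add_assoc μ 1 1, one_add_one_eq_two]
  unfold besselClifford
  rw [s₀.tsum_eq_zero_add, s₁.tsum_eq_zero_add, mul_add, ← tsum_mul_left, ← tsum_mul_left]
  have s₁' := ((summable_nat_add_iff 1).mpr s₁).mul_left (μ + 1)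
  have s₀' := (summable_nat_add_iff 1).mpr s₀
  have hzero : besselCliffordCoeff μ 0 = (μ + 1) * besselCliffordCoeff (μ + 1) 0 := by
    simpa using hcoeff₁ 0
  rw [hzero, ← mul_assoc, add_sub_add_left_eq_sub, ← s₁'.tsum_sub s₀']
  refine tsum_congr fun n => ?_
  have h₁ := hcoeff₁ (n + 1)
  have h₂ := hcoeff₂ n
  push_cast at h₁
  rw [h₁]
  linear_combination z ^ (n + 1) * h₂

end BesselClifford

/-- Solutions of `u'' = (c/t² - 1) u` are bounded on `[1, ∞)`. -/
theorem exists_abs_le_of_perturbed_oscillator {u v : ℝ → ℝ} {c : ℝ}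
    (hu : ∀ t > 0, HasDerivAt u (v t) t)
    (hv : ∀ t > 0, HasDerivAt v (c / t ^ 2 * u t - u t) t) :
    ∃ C, ∀ t ≥ 1, |u t| ≤ C := by
  set E : ℝ → ℝ := fun t => (u t ^ 2 + v t ^ 2) * Real.exp (|c| * t⁻¹) with hE
  have hderiv (t : ℝ) (ht : 0 < t) : HasDerivAt E
      (Real.exp (|c| * t⁻¹) / t ^ 2 * (2 * c * u t * v t - |c| * (u t ^ 2 + v t ^ 2))) t := by
    have h := (((hu t ht).pow 2).add ((hv t ht).pow 2)).mul
      (((hasDerivAt_inv ht.ne').const_mul |c|).exp)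
    refine h.congr_deriv ?_
    simp only [Pi.add_apply, Pi.pow_apply]
    field_simp
    ring
  have hanti : AntitoneOn E (Ici 1) := by
    refine antitoneOn_of_deriv_nonpos (convex_Ici 1)
      (fun t ht => (hderiv t (zero_lt_one.trans_le ht)).continuousAt.continuousWithinAt)
      (fun t ht => ?_) (fun t ht => ?_)
    all_goals
      rw [interior_Ici] at ht
      have ht' := hderiv t (zero_lt_one.trans ht)
    · exact ht'.differentiableAt.differentiableWithinAt
    · rw [ht'.deriv]
      refine mul_nonpos_of_nonneg_of_nonpos (by positivity) ?_
      rcases abs_cases c with ⟨h, hc⟩ | ⟨h, hc⟩ <;> rw [h]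
      · nlinarith [mul_nonneg hc (sq_nonneg (u t - v t))]
      · nlinarith [mul_nonneg (neg_nonneg.mpr hc.le) (sq_nonneg (u t + v t))]
  refine ⟨√(E 1), fun t ht => Real.abs_le_sqrt ?_⟩
  have hexp : 1 ≤ Real.exp (|c| * t⁻¹) := Real.one_le_exp (by positivity)
  calc u t ^ 2 ≤ u t ^ 2 + v t ^ 2 := le_add_of_nonneg_right (sq_nonneg _)
    _ ≤ E t := le_mul_of_one_le_right (by positivity) hexp
    _ ≤ E 1 := hanti self_mem_Ici ht ht

theorem hasDerivAt_besselClifford_sq {μ : ℝ} (hμ : -1 < μ) (t : ℝ) :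
    HasDerivAt (fun t => besselClifford μ ((t / 2) ^ 2))
      (-(t / 2) * besselClifford (μ + 1) ((t / 2) ^ 2)) t := by
  have hin : HasDerivAt (fun t : ℝ => (t / 2) ^ 2) (t / 2) t :=
    (((hasDerivAt_id t).div_const 2).pow 2).congr_deriv (by simp; ring)
  exact ((hasDerivAt_besselClifford hμ _).comp t hin).congr_deriv (by ring)

theorem sqrt_mul_besselJ {μ t : ℝ} (ht : 0 < t) :
    √t * besselJ μ t = (1 / 2) ^ μ * (t ^ (μ + 1 / 2) * besselClifford μ ((t / 2) ^ 2)) := by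
  rw [besselJ_eq_rpow_mul_besselClifford, Real.sqrt_eq_rpow, Real.rpow_add ht,
    div_eq_mul_one_div t, Real.mul_rpow ht.le (by norm_num)]
  ring

theorem exists_abs_rpow_mul_besselClifford_le {μ : ℝ} (hμ : -1 < μ) :
    ∃ C, ∀ t ≥ 1, |t ^ (μ + 1 / 2) * besselClifford μ ((t / 2) ^ 2)| ≤ C := by
  set ν := μ + 1 / 2 with hν
  have hμ' : -1 < μ + 1 := by linarith
  have hrpow (r : ℝ) {t : ℝ} (ht : 0 < t) :
      HasDerivAt (fun t : ℝ => t ^ r) (r * t ^ (r - 1)) t :=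
    Real.hasDerivAt_rpow_const (.inl ht.ne')
  refine exists_abs_le_of_perturbed_oscillator (c := ν * (ν - 1))
    (v := fun t => ν * (t ^ (ν - 1) * besselClifford μ ((t / 2) ^ 2)) -
      2⁻¹ * (t ^ (ν + 1) * besselClifford (μ + 1) ((t / 2) ^ 2)))
    (fun t ht => ?_) (fun t ht => ?_)
  · refine ((hrpow ν ht).mul (hasDerivAt_besselClifford_sq hμ t)).congr_deriv ?_
    rw [Real.rpow_add_one ht.ne']
    ring
  · refine ((((hrpow (ν - 1) ht).mul (hasDerivAt_besselClifford_sq hμ t)).const_mul ν).sub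
      (((hrpow (ν + 1) ht).mul
        (hasDerivAt_besselClifford_sq hμ' t)).const_mul 2⁻¹)).congr_deriv ?_
    have hrec := mul_besselClifford_add_two hμ ((t / 2) ^ 2)
    have htwo : μ + 1 + 1 = μ + 2 := by ring
    rw [htwo, add_sub_cancel_right, Real.rpow_add_one ht.ne', Real.rpow_sub_one ht.ne',
      Real.rpow_sub_one ht.ne']
    generalize besselClifford μ ((t / 2) ^ 2) = B₀ at hrec ⊢
    generalize besselClifford (μ + 1) ((t / 2) ^ 2) = B₁ at hrec ⊢
    generalize besselClifford (μ + 2) ((t / 2) ^ 2) = B₂ at hrec ⊢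
    field_simp
    rw [hν]
    linear_combination (4 * t ^ 2) * hrec

/-- `√t J_μ(t)` is `O(1)` and `O(t^(μ+1/2))` uniformly on `(0, ∞)`. -/
theorem exists_abs_sqrt_mul_besselJ_le {μ : ℝ} (hμ : -1 / 2 ≤ μ) :
    ∃ C > 0, ∀ t > 0, |√t * besselJ μ t| ≤ C ∧ |√t * besselJ μ t| ≤ C * t ^ (μ + 1 / 2) := by
  have hμ' : -1 < μ := by linarith
  obtain ⟨C₁, hC₁⟩ := exists_abs_rpow_mul_besselClifford_le hμ'
  have hcont : Continuous fun t : ℝ => besselClifford μ ((t / 2) ^ 2) :=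
    (continuous_besselClifford hμ').comp (by fun_prop)
  obtain ⟨C₂, hC₂⟩ := (isCompact_Icc (a := (0 : ℝ)) (b := 1)).exists_bound_of_continuousOn
    hcont.continuousOn
  have hpos : (0 : ℝ) < (1 / 2) ^ μ := by positivity
  have hν : 0 ≤ μ + 1 / 2 := by linarith
  set C := max (max C₁ C₂) 1
  have hC : 0 < C := lt_max_of_lt_right one_pos
  refine ⟨(1 / 2) ^ μ * C, by positivity, fun t ht => ?_⟩
  rw [sqrt_mul_besselJ ht, abs_mul, abs_of_pos hpos, mul_assoc]
  have htν : 0 < t ^ (μ + 1 / 2) := by positivity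
  rcases le_total t 1 with h1 | h1
  · have hb : |t ^ (μ + 1 / 2) * besselClifford μ ((t / 2) ^ 2)| ≤ C * t ^ (μ + 1 / 2) := by
      rw [abs_mul, abs_of_pos htν, mul_comm]
      gcongr
      exact (hC₂ t ⟨ht.le, h1⟩).trans ((le_max_right _ _).trans (le_max_left _ _))
    have hle : C * t ^ (μ + 1 / 2) ≤ C :=
      mul_le_of_le_one_right hC.le (Real.rpow_le_one ht.le h1 hν)
    constructor <;> gcongr
    exact hb.trans hle
  · have hb : |t ^ (μ + 1 / 2) * besselClifford μ ((t / 2) ^ 2)| ≤ C :=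
      (hC₁ t h1).trans ((le_max_left _ _).trans (le_max_left _ _))
    have hle : C ≤ C * t ^ (μ + 1 / 2) :=
      le_mul_of_one_le_right hC.le (Real.one_le_rpow h1 hν)
    constructor <;> gcongr
    exact hb.trans hle

theorem measurable_besselJ {μ : ℝ} (hμ : -1 < μ) : Measurable (besselJ μ) := by
  have h : besselJ μ = fun x => (x / 2) ^ μ * besselClifford μ ((x / 2) ^ 2) :=
    funext (besselJ_eq_rpow_mul_besselClifford μ)
  rw [h]
  exact ((measurable_id.div_const 2).pow_const μ).mul
    ((continuous_besselClifford hμ).measurable.comp (by fun_prop))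

theorem integrableOn_sqrt_mul_besselJ_mul_rpow {μ η : ℝ} (hη₁ : 3 / 2 < η) (hη₂ : η < μ + 2) :
    IntegrableOn (fun t => √t * besselJ μ t * t ^ (1 / 2 - η)) (Ioi 0) := by
  obtain ⟨C, -, hC⟩ := exists_abs_sqrt_mul_besselJ_le (μ := μ) (by linarith)
  have hmeas : Measurable fun t => √t * besselJ μ t * t ^ (1 / 2 - η) :=
    (Real.continuous_sqrt.measurable.mul (measurable_besselJ (by linarith))).mul
      (measurable_id.pow_const _)
  rw [← Ioc_union_Ioi_eq_Ioi zero_le_one]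
  refine IntegrableOn.union ?_ ?_
  · have h := ((intervalIntegral.integrableOn_Ioo_rpow_iff (s := μ + 1 - η) one_pos).mpr
      (by linarith)).const_mul C
    refine ((integrableOn_Ioc_iff_integrableOn_Ioo).mpr h).mono' hmeas.aestronglyMeasurable
      ((ae_restrict_mem measurableSet_Ioc).mono fun t ht => ?_)
    have ht0 : 0 < t := ht.1
    rw [norm_mul, Real.norm_eq_abs, Real.norm_eq_abs, abs_of_pos (Real.rpow_pos_of_pos ht0 _),
      show μ + 1 - η = (μ + 1 / 2) + (1 / 2 - η) by ring, Real.rpow_add ht0, ← mul_assoc]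
    gcongr
    exact (hC t ht0).2
  · refine ((integrableOn_Ioi_rpow_of_lt (a := 1 / 2 - η) (by linarith) one_pos).const_mul
      C).mono' hmeas.aestronglyMeasurable ((ae_restrict_mem measurableSet_Ioi).mono fun t ht => ?_)
    have ht0 : 0 < t := one_pos.trans ht
    rw [norm_mul, Real.norm_eq_abs, Real.norm_eq_abs, abs_of_pos (Real.rpow_pos_of_pos ht0 _)]
    gcongr
    exact (hC t ht0).1

/-- Weber's first exponential integral. -/
theorem integral_rpow_mul_besselJ_mul_exp_neg_mul_sq {μ p : ℝ} (hμ : -1 < μ) (hp : 0 < p) :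
    ∫ t in Ioi (0 : ℝ), t ^ (μ + 1) * besselJ μ t * Real.exp (-(t ^ 2 * p)) =
      (2 * p) ^ (-(μ + 1)) * Real.exp (-(1 / 4 * p⁻¹)) := by
  set x : ℝ := -(1 / 4 * p⁻¹) with hx
  set K : ℝ := (2 * p) ^ (-(μ + 1)) with hK
  set A : ℕ → ℝ := fun n => (1 / 2) ^ μ * (besselCliffordCoeff μ n * (1 / 4) ^ n) with hA
  set F : ℕ → ℝ → ℝ := fun n t => A n * (t ^ (2 * μ + 1 + 2 * n) * Real.exp (-p * t ^ (2 : ℝ)))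
    with hF
  have hexponent (n : ℕ) : -1 < 2 * μ + 1 + 2 * n := by
    have : (0 : ℝ) ≤ n := n.cast_nonneg
    linarith
  have hFint (n : ℕ) : IntegrableOn (F n) (Ioi 0) :=
    (integrableOn_rpow_mul_exp_neg_mul_rpow (hexponent n) two_pos hp).const_mul _
  have hval (n : ℕ) : A n * ∫ t in Ioi (0 : ℝ),
      t ^ (2 * μ + 1 + 2 * n) * Real.exp (-p * t ^ (2 : ℝ)) = K * (x ^ n / n.factorial) := by
    have hG := (Gamma_add_natCast_add_one_pos hμ n).ne'
    simp only [hA, besselCliffordCoeff]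
    rw [integral_rpow_mul_exp_neg_mul_rpow two_pos (hexponent n) hp,
      show (2 * μ + 1 + 2 * n + 1) / 2 = μ + n + 1 by ring,
      show -(2 * μ + 1 + 2 * n + 1) / 2 = -(μ + 1) + -(n : ℝ) by ring, Real.rpow_add hp,
      Real.rpow_neg hp.le (n : ℝ), Real.rpow_natCast, hK, Real.mul_rpow two_pos.le hp.le,
      neg_add, Real.rpow_add two_pos (-μ), Real.rpow_neg_one, Real.rpow_neg two_pos.le, hx,
      neg_pow (1 / 4 * p⁻¹), mul_pow, inv_pow, Real.div_rpow one_pos.le two_pos.le,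
      Real.one_rpow]
    field_simp
  have hnorm (n : ℕ) : ∫ t in Ioi (0 : ℝ), ‖F n t‖ = ‖K * (x ^ n / n.factorial)‖ := by
    have hnn : 0 ≤ ∫ t in Ioi (0 : ℝ),
        t ^ (2 * μ + 1 + 2 * n) * Real.exp (-p * t ^ (2 : ℝ)) :=
      setIntegral_nonneg measurableSet_Ioi fun t ht => by
        have : 0 < t := ht
        positivity
    rw [← hval, norm_mul, Real.norm_of_nonneg hnn, ← integral_const_mul]
    refine setIntegral_congr_fun measurableSet_Ioi fun t ht => ?_
    have : 0 < t := ht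
    simp only [hF]
    rw [norm_mul, Real.norm_of_nonneg (r := t ^ (_ : ℝ) * _) (by positivity)]
  have hexp : HasSum (fun n : ℕ => K * (x ^ n / n.factorial)) (K * Real.exp x) := by
    rw [Real.exp_eq_exp_ℝ]
    exact (NormedSpace.expSeries_div_hasSum_exp x).mul_left K
  have hsum := hasSum_integral_of_summable_integral_norm hFint
    (by simpa only [hnorm] using hexp.summable.norm)
  have heq : (fun n => ∫ t in Ioi (0 : ℝ), F n t) = fun n : ℕ => K * (x ^ n / n.factorial) :=
    funext fun n => by rw [← hval, ← integral_const_mul]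
  rw [heq] at hsum
  rw [hexp.unique hsum]
  refine setIntegral_congr_fun measurableSet_Ioi fun t ht => ?_
  have ht0 : 0 < t := ht
  have hterm (n : ℕ) : F n t = (t ^ (μ + 1) * (t / 2) ^ μ * Real.exp (-(t ^ 2 * p))) *
      (besselCliffordCoeff μ n * ((t / 2) ^ 2) ^ n) := by
    simp only [hF, hA]
    rw [show 2 * μ + 1 + 2 * n = (μ + 1) + μ + (2 * n : ℕ) by push_cast; ring,
      Real.rpow_add ht0, Real.rpow_add ht0, Real.rpow_natCast, Real.rpow_two, pow_mul,
      Real.div_rpow ht0.le two_pos.le, Real.div_rpow one_pos.le two_pos.le, Real.one_rpow,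
      div_pow t, div_pow (t ^ 2), div_pow 1, neg_mul, mul_comm p]
    norm_num
    ring
  simp only [hterm, tsum_mul_left]
  rw [besselJ_eq_rpow_mul_besselClifford, besselClifford]
  ring

theorem integral_rpow_mul_exp_neg_mul_inv {a c : ℝ} (ha : 0 < a) (hc : 0 < c) :
    ∫ p in Ioi (0 : ℝ), p ^ (-a - 1) * Real.exp (-(c * p⁻¹)) = (1 / c) ^ a * Real.Gamma a := by
  rw [← Real.integral_rpow_mul_exp_neg_mul_Ioi ha hc,
    ← integral_comp_rpow_Ioi _ (by norm_num : (-1 : ℝ) ≠ 0)]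
  refine setIntegral_congr_fun measurableSet_Ioi fun p hp => ?_
  have hp0 : 0 < p := hp
  simp only [smul_eq_mul]
  rw [Real.rpow_neg_one, Real.inv_rpow hp0.le, ← Real.rpow_neg hp0.le, ← mul_assoc, abs_neg,
    abs_one, one_mul, ← Real.rpow_add hp0, inv_inv]
  ring_nf

theorem integral_rpow_mul_exp_neg_sq_mul {s t : ℝ} (hs : 0 < s) (ht : 0 < t) :
    ∫ p in Ioi (0 : ℝ), p ^ (s - 1) * Real.exp (-(t ^ 2 * p)) =
      t ^ (-(2 * s)) * Real.Gamma s := by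
  rw [Real.integral_rpow_mul_exp_neg_mul_Ioi hs (by positivity), one_div,
    Real.inv_rpow (by positivity), ← Real.rpow_natCast, ← Real.rpow_mul ht.le,
    Real.rpow_neg ht.le]
  norm_num

theorem integral_sqrt_mul_besselJ_mul_rpow {μ η : ℝ} (hη₁ : 3 / 2 < η) (hη₂ : η < μ + 2) :
    ∫ t in Ioi (0 : ℝ), √t * besselJ μ t * t ^ (1 / 2 - η) = Hconst μ η := by
  have hμ : -1 < μ := by linarith
  set s := (μ + η) / 2 with hs
  have hs0 : 0 < s := by rw [hs]; linarith
  have hΓ : 0 < Real.Gamma s := Real.Gamma_pos_of_pos hs0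
  set f : ℝ → ℝ → ℝ := fun t p =>
    t ^ (μ + 1) * besselJ μ t * (p ^ (s - 1) * Real.exp (-(t ^ 2 * p))) with hf
  have hsplit {t : ℝ} (ht : 0 < t) :
      t ^ (μ + 1) * t ^ (-(2 * s)) = √t * t ^ (1 / 2 - η) := by
    rw [Real.sqrt_eq_rpow, ← Real.rpow_add ht, ← Real.rpow_add ht, hs]
    ring_nf
  have hint : Integrable (Function.uncurry f)
      ((volume.restrict (Ioi 0)).prod (volume.restrict (Ioi 0))) := by
    have hmeas : Measurable (Function.uncurry f) := by
      have := measurable_besselJ hμ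
      simp only [hf, Function.uncurry_def]
      fun_prop
    refine (integrable_prod_iff hmeas.aestronglyMeasurable).mpr ⟨?_, ?_⟩
    · refine (ae_restrict_mem measurableSet_Ioi).mono fun t ht => ?_
      have ht0 : 0 < t := ht
      have := integrableOn_rpow_mul_exp_neg_mul_rpow (p := 1) (s := s - 1) (b := t ^ 2)
        (by linarith) one_pos (by positivity)
      simp only [Real.rpow_one, neg_mul] at this
      exact this.const_mul (t ^ (μ + 1) * besselJ μ t)
    · refine IntegrableOn.congr_fun
        ((integrableOn_sqrt_mul_besselJ_mul_rpow hη₁ hη₂).norm.mul_const (Real.Gamma s))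
        (fun t ht => ?_) measurableSet_Ioi
      have ht0 : 0 < t := ht
      have hnorm : ∫ p in Ioi (0 : ℝ), ‖f t p‖ = ∫ p in Ioi (0 : ℝ),
          ‖t ^ (μ + 1) * besselJ μ t‖ * (p ^ (s - 1) * Real.exp (-(t ^ 2 * p))) :=
        setIntegral_congr_fun measurableSet_Ioi fun p hp => by
          have hp0 : 0 < p := hp
          simp only [hf]
          rw [norm_mul, Real.norm_of_nonneg (r := p ^ (_ : ℝ) * _) (by positivity)]
      simp only [Function.uncurry_apply_pair]
      rw [hnorm, integral_const_mul, integral_rpow_mul_exp_neg_sq_mul hs0 ht0, ← mul_assoc,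
        mul_right_comm (√t), ← hsplit ht0, mul_right_comm (t ^ (μ + 1)),
        norm_mul (_ * _) (t ^ (-(2 * s))),
        Real.norm_of_nonneg (r := t ^ (-(2 * s))) (by positivity)]
  have hswap := integral_integral_swap hint
  have hleft : ∫ t in Ioi (0 : ℝ), ∫ p in Ioi (0 : ℝ), f t p =
      (∫ t in Ioi (0 : ℝ), √t * besselJ μ t * t ^ (1 / 2 - η)) * Real.Gamma s := by
    rw [← integral_mul_const]
    refine setIntegral_congr_fun measurableSet_Ioi fun t ht => ?_
    simp only [hf]
    rw [integral_const_mul, integral_rpow_mul_exp_neg_sq_mul hs0 ht]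
    linear_combination besselJ μ t * Real.Gamma s * hsplit ht
  have hright : ∫ p in Ioi (0 : ℝ), ∫ t in Ioi (0 : ℝ), f t p =
      2 ^ (-(μ + 1)) * (4 ^ (1 + μ / 2 - η / 2) * Real.Gamma (1 + μ / 2 - η / 2)) := by
    have h4 := integral_rpow_mul_exp_neg_mul_inv (a := 1 + μ / 2 - η / 2) (c := 1 / 4)
      (by linarith) (by norm_num)
    rw [one_div_one_div] at h4
    rw [← h4, ← integral_const_mul]
    refine setIntegral_congr_fun measurableSet_Ioi fun p hp => ?_
    have hp0 : 0 < p := hp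
    have hpull : ∫ t in Ioi (0 : ℝ), f t p = p ^ (s - 1) *
        ∫ t in Ioi (0 : ℝ), t ^ (μ + 1) * besselJ μ t * Real.exp (-(t ^ 2 * p)) := by
      rw [← integral_const_mul]
      exact integral_congr_ae (.of_forall fun t => by simp only [hf]; ring)
    rw [hpull, integral_rpow_mul_besselJ_mul_exp_neg_mul_sq hμ hp0,
      Real.mul_rpow two_pos.le hp0.le,
      show -(1 + μ / 2 - η / 2) - 1 = (s - 1) + -(μ + 1) by rw [hs]; ring, Real.rpow_add hp0]
    ring
  have hfour : (4 : ℝ) ^ (1 + μ / 2 - η / 2) = 2 ^ (2 + μ - η) := by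
    rw [show (4 : ℝ) = 2 ^ (2 : ℝ) by norm_num, ← Real.rpow_mul two_pos.le]
    ring_nf
  have htwo : (2 : ℝ) ^ (-(μ + 1)) * 2 ^ (2 + μ - η) * 2 ^ (η - 1) = 1 := by
    rw [← Real.rpow_add two_pos, ← Real.rpow_add two_pos,
      show -(μ + 1) + (2 + μ - η) + (η - 1) = 0 by ring, Real.rpow_zero]
  rw [hleft, hright, hfour] at hswap
  rw [Hconst, ← add_div, ← hs, eq_div_iff (by positivity)]
  linear_combination 2 ^ (η - 1) * hswap + Real.Gamma (1 + μ / 2 - η / 2) * htwo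

section Hankel

variable {μ η : ℝ} {G : ℝ → ℂ}

theorem aestronglyMeasurable_hankel_integrand (hμ : -1 < μ) (hG : Measurable G) (s : ℝ)
    (ν : Measure ℝ) :
    AEStronglyMeasurable (fun x => ((√(x * s) * besselJ μ (x * s) : ℝ) : ℂ) * G x) ν := by
  have := measurable_besselJ hμ
  exact Measurable.aestronglyMeasurable (by fun_prop)

/-- If `x^(μ+1/2) G(x)` is integrable, the Hankel transform of `G` is `O(s^(μ+1/2))`. -/
theorem exists_norm_hankel_le (hμ : -1 / 2 ≤ μ) (hG : Measurable G)
    (hint : IntegrableOn (fun x => ((x ^ (μ + 1 / 2) : ℝ) : ℂ) * G x) (Ioi 0)) :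
    ∃ K, ∀ s > 0,
      IntegrableOn (fun x => ((√(x * s) * besselJ μ (x * s) : ℝ) : ℂ) * G x) (Ioi 0) ∧
      ‖hankel μ G s‖ ≤ s ^ (μ + 1 / 2) * K := by
  obtain ⟨C, -, hC⟩ := exists_abs_sqrt_mul_besselJ_le hμ
  refine ⟨C * ∫ x in Ioi (0 : ℝ), ‖((x ^ (μ + 1 / 2) : ℝ) : ℂ) * G x‖, fun s hs => ?_⟩
  have hbound : ∀ᵐ x ∂volume.restrict (Ioi (0 : ℝ)),
      ‖((√(x * s) * besselJ μ (x * s) : ℝ) : ℂ) * G x‖ ≤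
        s ^ (μ + 1 / 2) * (C * ‖((x ^ (μ + 1 / 2) : ℝ) : ℂ) * G x‖) := by
    refine (ae_restrict_mem measurableSet_Ioi).mono fun x hx => ?_
    have hx0 : 0 < x := hx
    have h := (hC (x * s) (by positivity)).2
    rw [Real.mul_rpow hx0.le hs.le] at h
    rw [norm_mul, norm_mul, Complex.norm_real, Complex.norm_real, Real.norm_eq_abs,
      Real.norm_of_nonneg (by positivity)]
    calc |√(x * s) * besselJ μ (x * s)| * ‖G x‖
        ≤ C * (x ^ (μ + 1 / 2) * s ^ (μ + 1 / 2)) * ‖G x‖ := by gcongr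
      _ = _ := by ring
  have hdom := (hint.norm.const_mul C).const_mul (s ^ (μ + 1 / 2))
  refine ⟨hdom.mono' (aestronglyMeasurable_hankel_integrand (by linarith) hG s _) hbound, ?_⟩
  rw [← integral_const_mul, ← integral_const_mul]
  exact norm_integral_le_of_norm_le hdom hbound

theorem tendsto_rpow_mul_hankel_zero (hμ : -1 / 2 ≤ μ) (hη : η < μ + 2) (hG : Measurable G)
    (hint : IntegrableOn (fun x => ((x ^ (μ + 1 / 2) : ℝ) : ℂ) * G x) (Ioi 0)) :
    Tendsto (fun s => ((s ^ (3 / 2 - η) : ℝ) : ℂ) * hankel μ G s) (nhdsWithin 0 (Ioi 0))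
      (nhds 0) := by
  obtain ⟨K, hK⟩ := exists_norm_hankel_le hμ hG hint
  have hlim : Tendsto (fun s : ℝ => s ^ (μ + 2 - η) * K) (nhdsWithin 0 (Ioi 0)) (nhds 0) := by
    have hpos : 0 < μ + 2 - η := by linarith
    have h := ((Real.continuous_rpow_const hpos.le).tendsto 0).mul_const K
    rw [Real.zero_rpow hpos.ne', zero_mul] at h
    exact h.mono_left nhdsWithin_le_nhds
  refine squeeze_zero_norm' (eventually_mem_nhdsWithin.mono fun s hs => ?_) hlim
  have hs0 : 0 < s := hs
  rw [norm_mul, Complex.norm_real, Real.norm_of_nonneg (by positivity),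
    show μ + 2 - η = (3 / 2 - η) + (μ + 1 / 2) by ring, Real.rpow_add hs0, mul_assoc]
  gcongr
  exact (hK s hs0).2

theorem integrableOn_hankel_integrand_of_norm_le (hη₁ : 3 / 2 < η) (hη₂ : η < μ + 2)
    (hG : Measurable G) {M : ℝ} (hM : ∀ x > 0, ‖G x‖ ≤ M * x ^ (1 / 2 - η)) {s : ℝ}
    (hs : 0 < s) :
    IntegrableOn (fun x => ((√(x * s) * besselJ μ (x * s) : ℝ) : ℂ) * G x) (Ioi 0) := by
  have hk : IntegrableOn (fun t => ‖√t * besselJ μ t * t ^ (1 / 2 - η)‖) (Ioi (0 * s)) := by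
    rw [zero_mul]
    exact (integrableOn_sqrt_mul_besselJ_mul_rpow hη₁ hη₂).norm
  rw [← integrableOn_Ioi_comp_mul_right_iff _ _ hs] at hk
  refine (hk.const_mul (M * (s ^ (1 / 2 - η))⁻¹)).mono'
    (aestronglyMeasurable_hankel_integrand (by linarith) hG s _)
    ((ae_restrict_mem measurableSet_Ioi).mono fun x hx => ?_)
  have hx0 : 0 < x := hx
  have hsη : 0 < s ^ (1 / 2 - η) := by positivity
  rw [norm_mul, norm_mul (_ * _), Complex.norm_real, Real.norm_of_nonneg (r := _ ^ _)
    (by positivity), Real.mul_rpow hx0.le hs.le]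
  calc ‖√(x * s) * besselJ μ (x * s)‖ * ‖G x‖
      ≤ ‖√(x * s) * besselJ μ (x * s)‖ * (M * x ^ (1 / 2 - η)) := by gcongr; exact hM x hx0
    _ = _ := by field_simp

theorem tendsto_rpow_mul_hankel_of_norm_le (hη₁ : 3 / 2 < η) (hη₂ : η < μ + 2)
    (hG : Measurable G) {M : ℝ} (hM : ∀ x > 0, ‖G x‖ ≤ M * x ^ (1 / 2 - η)) {A : ℂ}
    (hlim : Tendsto (fun x => ((x ^ (η - 1 / 2) : ℝ) : ℂ) * G x) atTop (nhds A)) :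
    Tendsto (fun s => ((s ^ (3 / 2 - η) : ℝ) : ℂ) * hankel μ G s) (nhdsWithin 0 (Ioi 0))
      (nhds (A * (Hconst μ η : ℂ))) := by
  have hmeasJ := measurable_besselJ (μ := μ) (by linarith)
  set F : ℝ → ℝ → ℂ := fun s t =>
    ((√t * besselJ μ t : ℝ) : ℂ) * (((s ^ (1 / 2 - η) : ℝ) : ℂ) * G (t * s⁻¹)) with hF
  have hscale {s t : ℝ} (hs : 0 < s) (ht : 0 < t) :
      s ^ (1 / 2 - η) = t ^ (1 / 2 - η) * (t * s⁻¹) ^ (η - 1 / 2) := by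
    have ht' : t ^ (1 / 2 - η) * t ^ (η - 1 / 2) = 1 := by
      rw [← Real.rpow_add ht]; norm_num
    rw [Real.mul_rpow ht.le (by positivity), ← mul_assoc, ht', one_mul, Real.inv_rpow hs.le,
      ← Real.rpow_neg hs.le, neg_sub]
  have hconv : Tendsto (fun s => ∫ t in Ioi (0 : ℝ), F s t) (nhdsWithin 0 (Ioi 0))
      (nhds (∫ t in Ioi (0 : ℝ), ((√t * besselJ μ t * t ^ (1 / 2 - η) : ℝ) : ℂ) * A)) := by
    refine tendsto_integral_filter_of_dominated_convergence
      (fun t => M * ‖√t * besselJ μ t * t ^ (1 / 2 - η)‖)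
      (.of_forall fun s => Measurable.aestronglyMeasurable (by simp only [hF]; fun_prop)) ?_
      ((integrableOn_sqrt_mul_besselJ_mul_rpow hη₁ hη₂).norm.const_mul M) ?_
    · refine eventually_mem_nhdsWithin.mono fun s hs =>
        (ae_restrict_mem measurableSet_Ioi).mono fun t ht => ?_
      have hs0 : 0 < s := hs
      have ht0 : 0 < t := ht
      have hcancel : s ^ (1 / 2 - η) * (t * s⁻¹) ^ (1 / 2 - η) = t ^ (1 / 2 - η) := by
        rw [← Real.mul_rpow hs0.le (by positivity)]
        congr 1
        field_simp
      simp only [hF]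
      rw [norm_mul, norm_mul, norm_mul (_ * _), Complex.norm_real, Complex.norm_real,
        Real.norm_of_nonneg (r := s ^ _) (by positivity),
        Real.norm_of_nonneg (r := t ^ _) (by positivity), ← hcancel]
      calc ‖√t * besselJ μ t‖ * (s ^ (1 / 2 - η) * ‖G (t * s⁻¹)‖)
          ≤ ‖√t * besselJ μ t‖ * (s ^ (1 / 2 - η) * (M * (t * s⁻¹) ^ (1 / 2 - η))) := by
            gcongr; exact hM _ (by positivity)
        _ = _ := by ring
    · refine (ae_restrict_mem measurableSet_Ioi).mono fun t ht => ?_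
      have ht0 : 0 < t := ht
      have hlim' := (hlim.comp (tendsto_inv_nhdsGT_zero.const_mul_atTop ht0)).const_mul
        (((√t * besselJ μ t * t ^ (1 / 2 - η) : ℝ) : ℂ))
      refine hlim'.congr' (eventually_mem_nhdsWithin.mono fun s hs => ?_)
      simp only [hF, Function.comp_apply]
      rw [hscale hs ht0]
      push_cast
      ring
  have hval : ∫ t in Ioi (0 : ℝ), ((√t * besselJ μ t * t ^ (1 / 2 - η) : ℝ) : ℂ) * A =
      A * (Hconst μ η : ℂ) := by
    rw [integral_mul_const, integral_complex_ofReal,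
      integral_sqrt_mul_besselJ_mul_rpow hη₁ hη₂, mul_comm]
  rw [hval] at hconv
  refine hconv.congr' (eventually_mem_nhdsWithin.mono fun s hs => ?_)
  have hs0 : 0 < s := hs
  have hsub := integral_comp_mul_right_Ioi
    (fun t => ((√t * besselJ μ t : ℝ) : ℂ) * G (t * s⁻¹)) 0 hs0
  simp only [mul_inv_cancel_right₀ hs0.ne', zero_mul] at hsub
  have hpow : s ^ (3 / 2 - η) * s⁻¹ = s ^ (1 / 2 - η) := by
    rw [← Real.rpow_neg_one, ← Real.rpow_add hs0]
    ring_nf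
  beta_reduce
  rw [hankel, hsub, Complex.real_smul, ← mul_assoc, ← Complex.ofReal_mul, hpow,
    ← integral_const_mul]
  exact integral_congr_ae (.of_forall fun t => by simp only [hF]; ring)

/-- Abelian final value theorem for the classical Hankel transform. -/
theorem tendsto_rpow_mul_hankel (hη₁ : 3 / 2 < η) (hη₂ : η < μ + 2) (hG : Measurable G)
    (hint : ∀ X > (0 : ℝ),
      IntegrableOn (fun x => ((x ^ (μ + 1 / 2) : ℝ) : ℂ) * G x) (Ioo 0 X))
    {A : ℂ} (hlim : Tendsto (fun x => ((x ^ (η - 1 / 2) : ℝ) : ℂ) * G x) atTop (nhds A)) :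
    Tendsto (fun s => ((s ^ (3 / 2 - η) : ℝ) : ℂ) * hankel μ G s) (nhdsWithin 0 (Ioi 0))
      (nhds (A * (Hconst μ η : ℂ))) := by
  have hμ : -1 / 2 ≤ μ := by linarith
  obtain ⟨X, hX0, hX⟩ : ∃ X > 0, ∀ x ≥ X, ‖((x ^ (η - 1 / 2) : ℝ) : ℂ) * G x‖ ≤ ‖A‖ + 1 := by
    obtain ⟨X, hX⟩ := eventually_atTop.mp
      (hlim.norm.eventually_le_const (lt_add_one ‖A‖))
    exact ⟨max X 1, by positivity, fun x hx => hX x ((le_max_left _ _).trans hx)⟩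
  set G₁ := (Ioo 0 X).indicator G with hG₁
  set G₂ := (Ici X).indicator G with hG₂
  have hG₁m : Measurable G₁ := hG.indicator measurableSet_Ioo
  have hG₂m : Measurable G₂ := hG.indicator measurableSet_Ici
  have hsplit {x : ℝ} (hx : 0 < x) : G x = G₁ x + G₂ x := by
    rcases lt_or_ge x X with h | h
    · simp [hG₁, hG₂, hx, h]
    · simp [hG₁, hG₂, h]
  have hint₁ : IntegrableOn (fun x => ((x ^ (μ + 1 / 2) : ℝ) : ℂ) * G₁ x) (Ioi 0) := by
    have h := ((integrable_indicator_iff measurableSet_Ioo).mpr (hint X hX0)).integrableOn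
      (s := Ioi 0)
    refine h.congr_fun (fun x _ => ?_) measurableSet_Ioi
    simp only [hG₁, indicator_apply]
    split_ifs <;> simp
  have hM (x : ℝ) (hx : x > 0) : ‖G₂ x‖ ≤ (‖A‖ + 1) * x ^ (1 / 2 - η) := by
    by_cases h : x ∈ Ici X
    · have hb := hX x h
      rw [norm_mul, Complex.norm_real, Real.norm_of_nonneg (by positivity)] at hb
      rw [hG₂, indicator_of_mem h, ← neg_sub, Real.rpow_neg hx.le, ← div_eq_mul_inv,
        le_div_iff₀ (by positivity), mul_comm]
      exact hb
    · rw [hG₂, indicator_of_notMem h, norm_zero]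
      positivity
  have hlim₂ : Tendsto (fun x => ((x ^ (η - 1 / 2) : ℝ) : ℂ) * G₂ x) atTop (nhds A) :=
    hlim.congr' ((eventually_ge_atTop X).mono fun x hx => by
      beta_reduce
      rw [hG₂, indicator_of_mem (mem_Ici.mpr hx)])
  obtain ⟨K, hK⟩ := exists_norm_hankel_le hμ hG₁m hint₁
  have hsum := (tendsto_rpow_mul_hankel_zero hμ hη₂ hG₁m hint₁).add
    (tendsto_rpow_mul_hankel_of_norm_le hη₁ hη₂ hG₂m hM hlim₂)
  rw [zero_add] at hsum
  refine hsum.congr' (eventually_mem_nhdsWithin.mono fun s hs => ?_)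
  have hadd : hankel μ G s = hankel μ G₁ s + hankel μ G₂ s := by
    unfold hankel
    rw [← integral_add (hK s hs).1
      (integrableOn_hankel_integrand_of_norm_le hη₁ hη₂ hG₂m hM hs)]
    refine setIntegral_congr_fun measurableSet_Ioi fun x hx => ?_
    rw [hsplit hx, mul_add]
  beta_reduce
  rw [hadd, mul_add]

end Hankel

theorem frht_eq_hankel (α μ : ℝ) (g : ℝ → ℂ) (ξ : ℝ) :
    frht α μ g ξ =
      Cst α μ * Complex.exp (-Complex.I * ((ξ ^ 2 * Real.cot α / 2 : ℝ) : ℂ)) *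
        hankel μ (fun x => Complex.exp (-Complex.I * ((x ^ 2 * Real.cot α / 2 : ℝ) : ℂ)) * g x)
          (ξ * (Real.sin α)⁻¹) := by
  unfold frht hankel
  rw [← integral_const_mul]
  refine integral_congr_ae (.of_forall fun x => ?_)
  have hexp : Complex.exp (-Complex.I * (((x ^ 2 + ξ ^ 2) / 2 * Real.cot α : ℝ) : ℂ)) =
      Complex.exp (-Complex.I * ((ξ ^ 2 * Real.cot α / 2 : ℝ) : ℂ)) *
        Complex.exp (-Complex.I * ((x ^ 2 * Real.cot α / 2 : ℝ) : ℂ)) := by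
    rw [← Complex.exp_add]
    congr 1
    push_cast
    ring
  simp only [frhtKernel]
  rw [hexp, mul_assoc x]
  ring

/-- Decomposition form of the final value theorem: `f = g + h` with `g`
satisfying the classical FVT hypotheses and `h` a compactly supported distribution on
`(0,∞)` whose transform `H(ξ) = ⟨h, K_α(·,ξ)⟩` satisfies `|H(ξ)| ≤ K ξ^{μ+1}` for
`0 < ξ < 1`; then `e^{iξ²c₁/2} ξ^{3/2-η} (H^α_μ f)(ξ) → δ H(μ,η)` as `ξ → 0⁺`. -/
theorem frht_final_value_distribution
    (μ η α : ℝ) (hμ : -1/2 ≤ μ) (hη1 : 3/2 < η) (hη2 : η < μ + 2)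
    (hα1 : 0 < α) (hα2 : α < Real.pi) (hα3 : α ≠ Real.pi / 2)
    (g : ℝ → ℂ) (δ : ℂ)
    (hmeas : Measurable g)
    (hint : ∀ X > (0 : ℝ),
      MeasureTheory.IntegrableOn (fun x => ((x ^ (μ + 1/2) : ℝ) : ℂ) * g x) (Set.Ioo 0 X))
    (hlim : Filter.Tendsto
      (fun x : ℝ => Complex.exp (-Complex.I * ((x ^ 2 * Real.cot α / 2 : ℝ) : ℂ)) *
        ((x ^ (η - 1/2) : ℝ) : ℂ) * g x)
      Filter.atTop
      (nhds (δ * ((((Real.sin α)⁻¹) ^ (3/2 - η) : ℝ) : ℂ) / Cst α μ)))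
    (h : (ℝ → ℂ) →ₗ[ℂ] ℂ) (a b : ℝ) (ha : 0 < a) (hab : a < b)
    (hsupp : ∀ φ : ℝ → ℂ, (∀ x ∈ Set.Icc a b, φ x = 0) → h φ = 0)
    (hH : ∃ K > (0 : ℝ), ∀ ξ : ℝ, 0 < ξ → ξ < 1 →
      ‖h (fun x => frhtKernel α μ x ξ)‖ ≤ K * ξ ^ (μ + 1)) :
    Filter.Tendsto
      (fun ξ : ℝ => Complex.exp (Complex.I * ((ξ ^ 2 * Real.cot α / 2 : ℝ) : ℂ)) *
        ((ξ ^ (3/2 - η) : ℝ) : ℂ) * (frht α μ g ξ + h (fun x => frhtKernel α μ x ξ)))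
      (nhdsWithin 0 (Set.Ioi 0)) (nhds (δ * (Hconst μ η : ℂ))) := by
  have hsin : 0 < Real.sin α := Real.sin_pos_of_pos_of_lt_pi hα1 hα2
  have hc : 0 < (Real.sin α)⁻¹ := inv_pos.mpr hsin
  have hC : Cst α μ ≠ 0 :=
    div_ne_zero (Complex.exp_ne_zero _) (Complex.ofReal_ne_zero.mpr hsin.ne')
  have hexp (ξ : ℝ) : ‖Complex.exp (Complex.I * ((ξ ^ 2 * Real.cot α / 2 : ℝ) : ℂ))‖ = 1 := by
    rw [mul_comm, Complex.norm_exp_ofReal_mul_I]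
  have hexp' (x : ℝ) :
      ‖Complex.exp (-Complex.I * ((x ^ 2 * Real.cot α / 2 : ℝ) : ℂ))‖ = 1 := by
    rw [neg_mul, ← mul_neg, ← Complex.ofReal_neg, mul_comm, Complex.norm_exp_ofReal_mul_I]
  set G : ℝ → ℂ := fun x =>
    Complex.exp (-Complex.I * ((x ^ 2 * Real.cot α / 2 : ℝ) : ℂ)) * g x with hGdef
  have hG : Measurable G := by simp only [hGdef]; fun_prop
  have hGint (X : ℝ) (hX : X > 0) :
      IntegrableOn (fun x => ((x ^ (μ + 1 / 2) : ℝ) : ℂ) * G x) (Ioo 0 X) := by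
    refine Integrable.mono (hint X hX) (Measurable.aestronglyMeasurable (by fun_prop))
      (.of_forall fun x => ?_)
    simp only [hGdef]
    rw [norm_mul, norm_mul, norm_mul, hexp', one_mul]
  have hclassical := tendsto_rpow_mul_hankel hη1 hη2 hG hGint
    (hlim.congr fun x => by simp only [hGdef]; ring)
  have hscale : Tendsto (fun ξ : ℝ => ξ * (Real.sin α)⁻¹) (nhdsWithin 0 (Ioi 0))
      (nhdsWithin 0 (Ioi 0)) := by
    refine tendsto_nhdsWithin_of_tendsto_nhds_of_eventually_within _ ?_
      (eventually_mem_nhdsWithin.mono fun ξ hξ => mul_pos hξ hc)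
    have h0 := (continuous_mul_const (Real.sin α)⁻¹).tendsto 0
    rw [zero_mul] at h0
    exact h0.mono_left nhdsWithin_le_nhds
  have hpow : 0 < (Real.sin α)⁻¹ ^ (3 / 2 - η) := by positivity
  have hpowC : (((Real.sin α)⁻¹ ^ (3 / 2 - η) : ℝ) : ℂ) ≠ 0 :=
    Complex.ofReal_ne_zero.mpr hpow.ne'
  have hfun := (hclassical.comp hscale).const_mul
    (Cst α μ / (((Real.sin α)⁻¹ ^ (3 / 2 - η) : ℝ) : ℂ))
  obtain ⟨K, hK0, hK⟩ := hH
  have hdist : Tendsto (fun ξ : ℝ =>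
      Complex.exp (Complex.I * ((ξ ^ 2 * Real.cot α / 2 : ℝ) : ℂ)) *
        ((ξ ^ (3 / 2 - η) : ℝ) : ℂ) * h (fun x => frhtKernel α μ x ξ))
      (nhdsWithin 0 (Ioi 0)) (nhds 0) := by
    have hpos : 0 < (3 / 2 - η) + (μ + 1) := by linarith
    have hzero : Tendsto (fun ξ : ℝ => K * ξ ^ ((3 / 2 - η) + (μ + 1)))
        (nhdsWithin 0 (Ioi 0)) (nhds 0) := by
      have h0 := ((Real.continuous_rpow_const hpos.le).tendsto 0).const_mul K
      rw [Real.zero_rpow hpos.ne', mul_zero] at h0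
      exact h0.mono_left nhdsWithin_le_nhds
    refine squeeze_zero_norm' ?_ hzero
    filter_upwards [Ioo_mem_nhdsGT one_pos] with ξ hξ
    have hξ0 : 0 < ξ := hξ.1
    rw [norm_mul, norm_mul, hexp, one_mul, Complex.norm_real,
      Real.norm_of_nonneg (by positivity), Real.rpow_add hξ0, mul_left_comm]
    gcongr
    exact hK ξ hξ0 hξ.2
  have hlimit : Cst α μ / (((Real.sin α)⁻¹ ^ (3 / 2 - η) : ℝ) : ℂ) *
      (δ * (((Real.sin α)⁻¹ ^ (3 / 2 - η) : ℝ) : ℂ) / Cst α μ * (Hconst μ η : ℂ)) + 0 =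
      δ * (Hconst μ η : ℂ) := by
    generalize (((Real.sin α)⁻¹ ^ (3 / 2 - η) : ℝ) : ℂ) = P at hpowC ⊢
    field_simp
    ring
  rw [← hlimit]
  refine (hfun.add hdist).congr' (eventually_mem_nhdsWithin.mono fun ξ hξ => ?_)
  have hcancel : Complex.exp (Complex.I * ((ξ ^ 2 * Real.cot α / 2 : ℝ) : ℂ)) *
      Complex.exp (-Complex.I * ((ξ ^ 2 * Real.cot α / 2 : ℝ) : ℂ)) = 1 := by
    rw [← Complex.exp_add, neg_mul, add_neg_cancel, Complex.exp_zero]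
  beta_reduce
  rw [mul_add, frht_eq_hankel, Function.comp_apply, Real.mul_rpow (le_of_lt hξ) hc.le,
    Complex.ofReal_mul]
  congr 1
  have hdiv : Cst α μ / (((Real.sin α)⁻¹ ^ (3 / 2 - η) : ℝ) : ℂ) *
      (((Real.sin α)⁻¹ ^ (3 / 2 - η) : ℝ) : ℂ) = Cst α μ := div_mul_cancel₀ _ hpowC
  linear_combination ((ξ ^ (3 / 2 - η) : ℝ) : ℂ) * hankel μ G (ξ * (Real.sin α)⁻¹) *
    (hdiv - Cst α μ * hcancel)
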